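/- Let n ≥ 1, M ≥ 1, let Ω₁, Ω₂ be real symmetric 2n×2n matrices, Ω₁₂ a real 2n×2n matrix, V₁, V₂, V₁₂, V₂₁ complex M×2n matrices, and Γ₁, Γ₂ : [0,∞) → ℝ^{M×M}. Define R = [[Ω₁, Ω₁₂],[Ω₁₂ᵀ, Ω₂]], V = [[V₁, V₁₂],[V₂₁, V₂]], Γ(t) = [[Γ₁(t), 0],[0, Γ₂(t)]], A_H = 2·J_{2n}·R and A_K(t) = 2·J_{2n}·Im(V†·Γ(t)·V). Suppose Ω₁ + Ω₁₂ = Ω₁₂ᵀ + Ω₂, and suppose for all t ≥ 0: Im(V₁†Γ₁(t)V₁ + V₂₁†Γ₂(t)V₂₁) + Im(V₁†Γ₁(t)V₁₂ + V₂₁†Γ₂(t)V₂) = Im(V₁₂†Γ₁(t)V₁ + V₂†Γ₂(t)V₂₁) + Im(V₁₂†Γ₁(t)V₁₂ + V₂†Γ₂(t)V₂). Then Π^⊥·A_H·Π = 0 and Π^⊥·A_K(t)·Π = 0 for all t ≥ 0. -/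

import Mathlib

open Matrix

/-- `J_k = I_k ⊗ J` where `J = [[0,1],[-1,0]]`: the `2k × 2k` block-diagonal matrix
with `2×2` blocks `J` (interleaved coordinate ordering). -/
def Jmat (k : ℕ) : Matrix (Fin (2*k)) (Fin (2*k)) ℝ :=
  Matrix.of fun i j =>
    if (i : ℕ) % 2 = 0 ∧ (j : ℕ) = (i : ℕ) + 1 then 1
    else if (i : ℕ) % 2 = 1 ∧ (j : ℕ) + 1 = (i : ℕ) then -1 else 0

/-- `J_{2n}` on the doubled (augmented) space, identified with
`fromBlocks (Jmat n) 0 0 (Jmat n)`. -/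
def J2n (n : ℕ) : Matrix (Fin (2*n) ⊕ Fin (2*n)) (Fin (2*n) ⊕ Fin (2*n)) ℝ :=
  Matrix.fromBlocks (Jmat n) 0 0 (Jmat n)

/-- Entrywise imaginary part of a complex matrix. -/
def matIm {m l : Type*} (A : Matrix m l ℂ) : Matrix m l ℝ := A.map Complex.im

/-- The orthogonal projection `Π = (1/2)[[I,I],[I,I]]`. -/
noncomputable def PiProj (n : ℕ) :
    Matrix (Fin (2*n) ⊕ Fin (2*n)) (Fin (2*n) ⊕ Fin (2*n)) ℝ :=
  (1/2 : ℝ) • Matrix.fromBlocks 1 1 1 1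

/-- The complementary projection `Π^⊥ = (1/2)[[I,-I],[-I,I]]`. -/
noncomputable def PiPerp (n : ℕ) :
    Matrix (Fin (2*n) ⊕ Fin (2*n)) (Fin (2*n) ⊕ Fin (2*n)) ℝ :=
  (1/2 : ℝ) • Matrix.fromBlocks 1 (-1) (-1) 1

/-- `Π^⊥ (c J_{2n} X) Π` vanishes when the two block rows of `X` have the same sum. -/
theorem PiPerp_mul_smul_J2n_mul_PiProj {n : ℕ} (c : ℝ)
    (A B C D : Matrix (Fin (2*n)) (Fin (2*n)) ℝ) (h : A + B = C + D) :
    PiPerp n * (c • (J2n n * Matrix.fromBlocks A B C D)) * PiProj n = 0 := by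
  have key : Matrix.fromBlocks A B C D * Matrix.fromBlocks 1 1 1 1
      = Matrix.fromBlocks (A + B) (A + B) (A + B) (A + B) := by
    simp [Matrix.fromBlocks_multiply, ← h]
  simp only [PiPerp, PiProj, J2n, smul_mul_assoc, mul_smul_comm, Matrix.mul_assoc, key]
  simp [Matrix.fromBlocks_multiply]

theorem matIm_fromBlocks {m l m' l' : Type*} (A : Matrix m l ℂ) (B : Matrix m l' ℂ)
    (C : Matrix m' l ℂ) (D : Matrix m' l' ℂ) :
    matIm (Matrix.fromBlocks A B C D)
      = Matrix.fromBlocks (matIm A) (matIm B) (matIm C) (matIm D) :=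
  Matrix.fromBlocks_map A B C D Complex.im

theorem stmt_12 {n M : ℕ} (hn : 1 ≤ n) (hM : 1 ≤ M)
    (Ω₁ Ω₂ Ω₁₂ : Matrix (Fin (2*n)) (Fin (2*n)) ℝ)
    (hΩ₁sym : Ω₁ᵀ = Ω₁) (hΩ₂sym : Ω₂ᵀ = Ω₂)
    (V₁ V₂ V₁₂ V₂₁ : Matrix (Fin M) (Fin (2*n)) ℂ)
    (Γ₁ Γ₂ : ℝ → Matrix (Fin M) (Fin M) ℝ)
    (R : Matrix (Fin (2*n) ⊕ Fin (2*n)) (Fin (2*n) ⊕ Fin (2*n)) ℝ)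
    (hR : R = Matrix.fromBlocks Ω₁ Ω₁₂ Ω₁₂ᵀ Ω₂)
    (V : Matrix (Fin M ⊕ Fin M) (Fin (2*n) ⊕ Fin (2*n)) ℂ)
    (hV : V = Matrix.fromBlocks V₁ V₁₂ V₂₁ V₂)
    (Γ : ℝ → Matrix (Fin M ⊕ Fin M) (Fin M ⊕ Fin M) ℂ)
    (hΓ : ∀ t, Γ t = Matrix.fromBlocks ((Γ₁ t).map Complex.ofReal) 0 0
      ((Γ₂ t).map Complex.ofReal))
    (AH : Matrix (Fin (2*n) ⊕ Fin (2*n)) (Fin (2*n) ⊕ Fin (2*n)) ℝ)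
    (hAH : AH = (2 : ℝ) • (J2n n * R))
    (AK : ℝ → Matrix (Fin (2*n) ⊕ Fin (2*n)) (Fin (2*n) ⊕ Fin (2*n)) ℝ)
    (hAK : ∀ t, AK t = (2 : ℝ) • (J2n n * matIm (Vᴴ * Γ t * V)))
    (hΩ : Ω₁ + Ω₁₂ = Ω₁₂ᵀ + Ω₂)
    (hIm : ∀ t ≥ (0:ℝ),
      matIm (V₁ᴴ * (Γ₁ t).map Complex.ofReal * V₁ + V₂₁ᴴ * (Γ₂ t).map Complex.ofReal * V₂₁)
      + matIm (V₁ᴴ * (Γ₁ t).map Complex.ofReal * V₁₂ + V₂₁ᴴ * (Γ₂ t).map Complex.ofReal * V₂)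
      = matIm (V₁₂ᴴ * (Γ₁ t).map Complex.ofReal * V₁ + V₂ᴴ * (Γ₂ t).map Complex.ofReal * V₂₁)
      + matIm (V₁₂ᴴ * (Γ₁ t).map Complex.ofReal * V₁₂ + V₂ᴴ * (Γ₂ t).map Complex.ofReal * V₂)) :
    PiPerp n * AH * PiProj n = 0 ∧ ∀ t ≥ (0:ℝ), PiPerp n * AK t * PiProj n = 0 := by
  subst hR hV hAH
  refine ⟨PiPerp_mul_smul_J2n_mul_PiProj _ _ _ _ _ hΩ, fun t ht => ?_⟩
  rw [hAK, hΓ, Matrix.fromBlocks_conjTranspose, Matrix.fromBlocks_multiply,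
    Matrix.fromBlocks_multiply, matIm_fromBlocks]
  apply PiPerp_mul_smul_J2n_mul_PiProj
  simpa using hIm t ht
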